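/- arXiv:math/0504361 — 2 statements merged into one kernel-verified Lean document; each statement's English description precedes it below -/
import Mathlib

section
/- Let B be a unital algebra and β ∈ Mul[[B]] with β_0 invertible. Define T̃_β = (β ∘ (Iβ)°⁻¹)(1 + I)^{-1}. Then T̃_β is the unique element of Mul[[B]] satisfying (T̃_β ∘ (Iβ))(1 + Iβ) = β. -/
/-!  Formal multilinear function series over an algebra `B`, encoded as functions
`F : List B → B`; the `n`-th term of the series is the restriction of `F` to
lists of length `n` (so `F [] = α₀`, `F [b] = α₁(b)`, etc.). -/

/-- `F : List B → B` is a formal multilinear function series over the `K`-algebra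
`B`: it is `K`-multilinear in the entries of lists of each fixed length. -/
def IsMulSeries (K : Type*) [Field K] {B : Type*} [Ring B] [Algebra K B]
    (F : List B → B) : Prop :=
  ∀ (p s : List B) (c : K) (x y : B),
    F (p ++ (c • x + y) :: s) = c • F (p ++ x :: s) + F (p ++ y :: s)

/-- The formal product:
`(αβ)ₙ(b₁,...,bₙ) = ∑_{k=0}^n αₖ(b₁,...,bₖ) β_{n-k}(b_{k+1},...,bₙ)`. -/
def fmul {B : Type*} [Ring B] (α β : List B → B) : List B → B :=
  fun l => ∑ i ∈ Finset.range (l.length + 1), α (List.take i l) * β (List.drop i l)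

/-- All decompositions of a list into consecutive nonempty blocks. -/
def comps {X : Type*} : List X → List (List (List X))
  | [] => [[]]
  | a :: t =>
      ((comps t).map fun c => [a] :: c) ++
      ((comps t).filterMap fun c =>
        match c with
        | [] => none
        | b :: bs => some ((a :: b) :: bs))

/-- The formal composition:
`(α∘β)ₙ(b₁,...,bₙ) = ∑_{k=1}^n ∑_{p₁+⋯+p_k=n, pᵢ≥1}
   αₖ(β_{p₁}(b₁,...,b_{p₁}), ..., β_{p_k}(b_{q_k+1},...,b_{q_k+p_k}))`,
with `(α∘β)₀ = α₀`. -/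
def fcomp {B : Type*} [Ring B] (α β : List B → B) : List B → B :=
  fun l => ((comps l).map fun c => α (c.map β)).sum

/-- The multiplicative identity `1 = (1, 0, 0, ...)` of `Mul[[B]]`. -/
def fmfsOne {B : Type*} [Ring B] : List B → B
  | [] => 1
  | _ :: _ => 0

/-- The compositional identity `I = (0, id_B, 0, 0, ...)` of `Mul[[B]]`. -/
def fmfsI {B : Type*} [Ring B] : List B → B
  | [x] => x
  | _ => 0

section Helpers

/-- Sum over all splittings of a list into a prefix and a suffix. -/
def cv {X M : Type*} [AddCommMonoid M] : (List X → List X → M) → List X → M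
  | F, [] => F [] []
  | F, a :: t => F [] (a :: t) + cv (fun u v => F (a :: u) v) t

/-- Sum over all decompositions into blocks. -/
def cS {X M : Type*} [AddCommMonoid M] (f : List (List X) → M) (l : List X) : M :=
  ((comps l).map f).sum

theorem cv_eq_sum {X M : Type*} [AddCommMonoid M] (l : List X) :
    ∀ F : List X → List X → M,
    cv F l = ∑ i ∈ Finset.range (l.length + 1), F (List.take i l) (List.drop i l) := by
  induction l with
  | nil => intro F; simp [cv]
  | cons a t ih =>
    intro F
    rw [cv, ih, List.length_cons, Finset.sum_range_succ' _ (t.length + 1), add_comm]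
    simp

theorem cv_congr {X M : Type*} [AddCommMonoid M] (l : List X) :
    ∀ F G : List X → List X → M, (∀ u v, u ++ v = l → F u v = G u v) → cv F l = cv G l := by
  induction l with
  | nil => intro F G h; simpa [cv] using h [] [] rfl
  | cons a t ih =>
    intro F G h
    rw [cv, cv, h [] (a :: t) rfl]
    congr 1
    apply ih
    intro u v huv
    exact h _ _ (by simp [huv])

theorem cv_add {X M : Type*} [AddCommMonoid M] (l : List X) :
    ∀ F G : List X → List X → M, cv (fun u v => F u v + G u v) l = cv F l + cv G l := by
  induction l with
  | nil => intro F G; simp [cv]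
  | cons a t ih => intro F G; simp only [cv, ih]; exact add_add_add_comm _ _ _ _

theorem cv_map {X M N : Type*} [AddCommMonoid M] [AddCommMonoid N] (h : M →+ N) (l : List X) :
    ∀ F : List X → List X → M, cv (fun u v => h (F u v)) l = h (cv F l) := by
  induction l with
  | nil => intro F; simp [cv]
  | cons a t ih => intro F; simp only [cv, ih, map_add]

theorem cv_zero {X M : Type*} [AddCommMonoid M] (l : List X) :
    cv (fun _ _ => (0 : M)) l = 0 := by
  induction l with
  | nil => simp [cv]
  | cons a t ih => simp [cv, ih]

theorem cv_mapList {X Y M : Type*} [AddCommMonoid M] (g : X → Y) (l : List X) :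
    ∀ F : List Y → List Y → M,
      cv F (l.map g) = cv (fun u v => F (u.map g) (v.map g)) l := by
  induction l with
  | nil => intro F; simp [cv]
  | cons a t ih => intro F; simp [cv, ih]

theorem cv_fubini {X M : Type*} [AddCommMonoid M] (l : List X) :
    ∀ F : List X → List X → List X → M,
      cv (fun u v => cv (fun v1 v2 => F u v1 v2) v) l =
      cv (fun w v2 => cv (fun u v1 => F u v1 v2) w) l := by
  induction l with
  | nil => intro F; simp [cv]
  | cons a t ih =>
    intro F
    simp only [cv]
    rw [ih, cv_add, add_assoc]

theorem cS_nil {X M : Type*} [AddCommMonoid M] (f : List (List X) → M) :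
    cS f [] = f [] := by simp [cS, comps]

theorem cS_add {X M : Type*} [AddCommMonoid M] (f g : List (List X) → M) (l : List X) :
    cS (fun c => f c + g c) l = cS f l + cS g l := by
  simp [cS, List.sum_map_add]

theorem cS_map {X M N : Type*} [AddCommMonoid M] [AddCommMonoid N] (h : M →+ N)
    (f : List (List X) → M) (l : List X) :
    cS (fun c => h (f c)) l = h (cS f l) := by
  simp [cS, map_list_sum, Function.comp_def]

theorem cS_step {X M : Type*} [AddCommMonoid M] (f : List (List X) → M) (a : X) (t : List X) :
    cS f (a :: t) = cS (fun c => f ([a] :: c)) t +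
      cS (fun c => match c with
        | [] => 0
        | b :: bs => f ((a :: b) :: bs)) t := by
  unfold cS
  rw [comps, List.map_append, List.sum_append, List.map_map]
  congr 1
  induction comps t with
  | nil => simp
  | cons c cs ih =>
    cases c with
    | nil => simpa using ih
    | cons b bs => simpa using congrArg (f ((a :: b) :: bs) + ·) ih

theorem cS_cons {X M : Type*} [AddCommMonoid M] (t : List X) :
    ∀ (f : List (List X) → M) (a : X),
    cS f (a :: t) = cv (fun u v => cS (fun c => f ((a :: u) :: c)) v) t := by
  induction t with
  | nil => intro f a; rw [cS_step]; simp [cS_nil, cv]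
  | cons b t ih =>
    intro f a
    rw [cS_step, ih (fun c => match c with
        | [] => 0
        | b :: bs => f ((a :: b) :: bs))]
    rfl

theorem cS_cv {X M : Type*} [AddCommMonoid M] (n : ℕ) : ∀ (l : List X), l.length ≤ n →
    ∀ F : List (List X) → List (List X) → M,
    cS (fun c => cv F c) l = cv (fun v1 v2 => cS (fun c1 => cS (fun c2 => F c1 c2) v2) v1) l := by
  induction n with
  | zero =>
    intro l hl F
    obtain rfl : l = [] := by simpa using hl
    simp [cS_nil, cv]
  | succ n ih =>
    intro l hl F
    cases l with
    | nil => simp [cS_nil, cv]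
    | cons a t =>
      rw [cS_cons]
      simp only [cv, cS_add, cv_add, cS_nil]
      rw [← cS_cons t (fun c => F [] c) a]
      congr 1
      simp only [cS_cons _ _ a]
      rw [← cv_fubini]
      apply cv_congr
      intro u v huv
      apply ih
      have := congrArg List.length huv
      simp at this hl
      omega

variable {K : Type*} [Field K] {B : Type*} [Ring B] [Algebra K B]

theorem fmul_eq (α β : List B → B) (l : List B) :
    fmul α β l = cv (fun u v => α u * β v) l := by
  rw [cv_eq_sum]; rfl

theorem fcomp_eq (α β : List B → B) (l : List B) :
    fcomp α β l = cS (fun c => α (c.map β)) l := rfl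

theorem fcomp_nil (α β : List B → B) : fcomp α β [] = α [] := by simp [fcomp_eq, cS_nil]

theorem fcomp_cons (α β : List B → B) (a : B) (t : List B) :
    fcomp α β (a :: t) = cv (fun u v => fcomp (fun m => α (β (a :: u) :: m)) β v) t := by
  rw [fcomp_eq, cS_cons]; rfl

theorem fmul_nil (α β : List B → B) : fmul α β [] = α [] * β [] := by simp [fmul_eq, cv]

theorem fmul_cons (α β : List B → B) (a : B) (t : List B) :
    fmul α β (a :: t) = α [] * β (a :: t) + fmul (fun m => α (a :: m)) β t := by
  simp [fmul_eq, cv]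

theorem fmul_assoc (α β γ : List B → B) : fmul (fmul α β) γ = fmul α (fmul β γ) := by
  funext l
  simp only [fmul_eq]
  have h1 : ∀ u v : List B, cv (fun u v => α u * β v) u * γ v =
      cv (fun u1 u2 => α u1 * β u2 * γ v) u := fun u v =>
    (cv_map (AddMonoidHom.mulRight (γ v)) u _).symm
  have h2 : ∀ u v : List B, α u * cv (fun u v => β u * γ v) v =
      cv (fun u1 u2 => α u * (β u1 * γ u2)) v := fun u v =>
    (cv_map (AddMonoidHom.mulLeft (α u)) v _).symm
  simp only [h1, h2, ← mul_assoc]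
  rw [← cv_fubini]

theorem fmul_zero_left (β : List B → B) (l : List B) : fmul (fun _ => 0) β l = 0 := by
  simp [fmul_eq, cv_zero]

theorem one_fmul (β : List B → B) : fmul fmfsOne β = β := by
  funext l
  cases l with
  | nil => simp [fmul_nil, fmfsOne]
  | cons a t => simp [fmul_cons, fmfsOne, fmul_zero_left]

theorem fmul_one (l : List B) : ∀ β : List B → B, fmul β fmfsOne l = β l := by
  induction l with
  | nil => intro β; simp [fmul_nil, fmfsOne]
  | cons a t ih => intro β; rw [fmul_cons, ih]; simp [fmfsOne]

theorem fmul_I_nil (β : List B → B) : fmul fmfsI β [] = 0 := by simp [fmul_nil, fmfsI]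

theorem fmul_I_cons (β : List B → B) (a : B) (t : List B) :
    fmul fmfsI β (a :: t) = a * β t := by
  rw [fmul_cons]
  cases t with
  | nil => simp [fmul_nil, fmfsI]
  | cons b t => simp [fmul_cons, fmfsI, fmul_zero_left]

theorem fcomp_fmul (α α' β : List B → B) :
    fcomp (fmul α α') β = fmul (fcomp α β) (fcomp α' β) := by
  funext l
  simp only [fcomp_eq, fmul_eq, cv_mapList]
  rw [cS_cv l.length l le_rfl]
  apply cv_congr
  intro u v _
  rw [← AddMonoidHom.mulRight_apply, ← cS_map]
  congr 1
  funext c1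
  exact cS_map (AddMonoidHom.mulLeft (α (c1.map β))) _ v

theorem IsMulSeries.add {F : List B → B} (h : IsMulSeries K F) (p s : List B) (x y : B) :
    F (p ++ (x + y) :: s) = F (p ++ x :: s) + F (p ++ y :: s) := by
  simpa using h p s 1 x y

theorem IsMulSeries.zero {F : List B → B} (h : IsMulSeries K F) (p s : List B) :
    F (p ++ 0 :: s) = 0 := by
  simpa using h.add p s 0 0

theorem IsMulSeries.tail {F : List B → B} (h : IsMulSeries K F) (a : B) :
    IsMulSeries K (fun m => F (a :: m)) := fun p s c x y => h (a :: p) s c x y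

theorem fcomp_zero_left (β : List B → B) (l : List B) : fcomp (fun _ => 0) β l = 0 := by
  simp [fcomp]

theorem fcomp_add_left (α α' β : List B → B) (l : List B) :
    fcomp (fun m => α m + α' m) β l = fcomp α β l + fcomp α' β l := cS_add _ _ _

theorem fcomp_smul_left (c : K) (α β : List B → B) (l : List B) :
    fcomp (fun m => c • α m) β l = c • fcomp α β l :=
  cS_map (DistribSMul.toAddMonoidHom B c) _ _

theorem fcomp_mul_left (c : B) (α β : List B → B) (l : List B) :
    fcomp (fun m => c * α m) β l = c * fcomp α β l :=
  cS_map (AddMonoidHom.mulLeft c) _ _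

theorem fcomp_assoc (β γ : List B → B) (n : ℕ) : ∀ (l : List B), l.length ≤ n →
    ∀ (α : List B → B), IsMulSeries K α →
    fcomp (fcomp α β) γ l = fcomp α (fcomp β γ) l := by
  induction n with
  | zero =>
    intro l hl α _
    obtain rfl : l = [] := by simpa using hl
    simp [fcomp_nil]
  | succ n ih =>
    intro l hl α hα
    cases l with
    | nil => simp [fcomp_nil]
    | cons a t =>
      rw [fcomp_cons, fcomp_cons]
      -- the right-hand side
      have hR : ∀ w v2 : List B,
          fcomp (fun m => α (fcomp β γ (a :: w) :: m)) (fcomp β γ) v2 =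
          cv (fun u v1 => cS (fun c1 =>
            fcomp (fun m => α (β (γ (a :: u) :: c1.map γ) :: m)) (fcomp β γ) v2) v1) w := by
        intro w v2
        let h : B →+ B :=
          { toFun := fun x => fcomp (fun m => α (x :: m)) (fcomp β γ) v2
            map_zero' := by
              have : (fun m => α (0 :: m)) = fun _ => 0 := by
                funext m; exact hα.zero [] m
              simp only [this, fcomp_zero_left]
            map_add' := by
              intro x y
              have : (fun m => α ((x + y) :: m)) = fun m => α (x :: m) + α (y :: m) := by
                funext m; exact hα.add [] m x y
              simp only [this, fcomp_add_left] }
        change h (fcomp β γ (a :: w)) = cv (fun u v1 => cS (fun c1 =>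
            h (β (γ (a :: u) :: c1.map γ))) v1) w
        simp only [cS_map, cv_map]
        rw [fcomp_cons]
        rfl
      simp only [hR]
      rw [← cv_fubini]
      apply cv_congr
      intro u v huv
      rw [fcomp_eq]
      simp only [fcomp_cons, cv_mapList]
      rw [cS_cv v.length v le_rfl]
      apply cv_congr
      intro v1 v2 hv
      congr 1
      funext c1
      apply ih
      · have h1 := congrArg List.length huv
        have h2 := congrArg List.length hv
        simp at h1 h2 hl
        omega
      · exact hα.tail _

theorem fcomp_assoc' {α : List B → B} (hα : IsMulSeries K α) (β γ : List B → B) :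
    fcomp (fcomp α β) γ = fcomp α (fcomp β γ) :=
  funext fun l => fcomp_assoc β γ l.length l le_rfl α hα

theorem one_fcomp (β : List B → B) : fcomp fmfsOne β = fmfsOne := by
  funext l
  cases l with
  | nil => simp [fcomp_nil]
  | cons a t => simp [fcomp_cons, fmfsOne, fcomp_zero_left, cv_zero]

theorem I_fcomp (β : List B → B) (h0 : β [] = 0) : fcomp fmfsI β = β := by
  funext l
  cases l with
  | nil => simp [fcomp_nil, h0, fmfsI]
  | cons a t =>
    have : ∀ x : B, (fun m => fmfsI (x :: m)) = fun m => x * fmfsOne m := by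
      intro x; funext m; cases m <;> simp [fmfsI, fmfsOne]
    simp only [fcomp_cons, this, fcomp_mul_left, one_fcomp]
    rw [← fmul_eq (fun u => β (a :: u)) fmfsOne, fmul_one]

theorem fcomp_I (l : List B) : ∀ α : List B → B, IsMulSeries K α → fcomp α fmfsI l = α l := by
  induction l with
  | nil => intro α _; simp [fcomp_nil]
  | cons a t ih =>
    intro α hα
    rw [fcomp_cons]
    cases t with
    | nil => simp [cv, fcomp_nil, fmfsI]
    | cons b t =>
      have h0 : (fun m => α (0 :: m)) = fun _ => 0 := by
        funext m; exact hα.zero [] m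
      rw [cv]
      simp only [fmfsI, h0, fcomp_zero_left, cv_zero, add_zero]
      exact ih _ (hα.tail a)

theorem fcomp_congr (x y : List B → B) (n : ℕ) (hxy : ∀ l, l.length ≤ n → x l = y l) (k : ℕ) :
    ∀ (l : List B), l.length ≤ k → l.length ≤ n →
    ∀ (α : List B → B), fcomp α x l = fcomp α y l := by
  induction k with
  | zero =>
    intro l hl _ α
    obtain rfl : l = [] := by simpa using hl
    simp [fcomp_nil]
  | succ k ih =>
    intro l hl hn α
    cases l with
    | nil => simp [fcomp_nil]
    | cons a t =>
      rw [fcomp_cons, fcomp_cons]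
      apply cv_congr
      intro u v huv
      have h1 := congrArg List.length huv
      simp at h1 hl hn
      rw [hxy (a :: u) (by simp; omega)]
      exact ih v (by omega) (by omega) _

theorem cv_lin (c : K) (x y : B) (s : List B) (p : List B) :
    ∀ F : List B → List B → B,
    (∀ q s v, F (q ++ (c • x + y) :: s) v = c • F (q ++ x :: s) v + F (q ++ y :: s) v) →
    (∀ u q, u ++ q = p → F u (q ++ (c • x + y) :: s) =
      c • F u (q ++ x :: s) + F u (q ++ y :: s)) →
    cv F (p ++ (c • x + y) :: s) = c • cv F (p ++ x :: s) + cv F (p ++ y :: s) := by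
  have hs : ∀ (l : List B) (F : List B → List B → B),
      cv (fun u v => c • F u v) l = c • cv F l := fun l F =>
    cv_map (DistribSMul.toAddMonoidHom B c) l F
  induction p with
  | nil =>
    intro F h1 h2
    have e1 := h2 [] [] rfl
    have e2 := fun u v => h1 [] u v
    simp only [List.nil_append] at e1 e2 ⊢
    simp only [cv, e1, e2, cv_add, hs, smul_add]
    exact add_add_add_comm _ _ _ _
  | cons a p ih =>
    intro F h1 h2
    have e1 := h2 [] (a :: p) rfl
    have e2 := ih (fun u v => F (a :: u) v) (fun q s v => h1 (a :: q) s v)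
      (fun u q h => h2 (a :: u) q (by simp [h]))
    simp only [List.cons_append] at e1 ⊢
    simp only [cv, e1, e2, smul_add]
    exact add_add_add_comm _ _ _ _

theorem IsMulSeries.fmul {α β : List B → B} (hα : IsMulSeries K α) (hβ : IsMulSeries K β) :
    IsMulSeries K (fmul α β) := by
  intro p s c x y
  simp only [fmul_eq]
  apply cv_lin
  · intro q s v; rw [hα, add_mul, smul_mul_assoc]
  · intro u q _; rw [hβ, mul_add, mul_smul_comm]

theorem fcomp_lin {β : List B → B} (hβ : IsMulSeries K β) (n : ℕ) :
    ∀ p : List B, p.length ≤ n → ∀ (s : List B) (c : K) (x y : B) (α : List B → B),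
    IsMulSeries K α → fcomp α β (p ++ (c • x + y) :: s) =
      c • fcomp α β (p ++ x :: s) + fcomp α β (p ++ y :: s) := by
  have key : ∀ (α : List B → B), IsMulSeries K α → ∀ (c : K) (x y : B) (l : List B),
      fcomp (fun m => α ((c • x + y) :: m)) β l =
      c • fcomp (fun m => α (x :: m)) β l + fcomp (fun m => α (y :: m)) β l := by
    intro α hα c x y l
    rw [← fcomp_smul_left, ← fcomp_add_left]
    congr 1
    funext m
    exact hα [] m c x y
  induction n with
  | zero =>
    intro p hp s c x y α hα
    obtain rfl : p = [] := by simpa using hp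
    have e := fun u => hβ [] u c x y
    simp only [List.nil_append] at e ⊢
    simp only [fcomp_cons, e, key α hα, cv_add]
    congr 1
    exact cv_map (DistribSMul.toAddMonoidHom B c) s _
  | succ n ih =>
    intro p hp s c x y α hα
    cases p with
    | nil => exact ih [] (by simp) s c x y α hα
    | cons a p =>
      simp only [List.cons_append, fcomp_cons]
      apply cv_lin
      · intro q s v
        have e := hβ (a :: q) s c x y
        simp only [List.cons_append] at e
        rw [e, key α hα]
      · intro u q h
        have h1 := congrArg List.length h
        simp at h1 hp
        exact ih q (by omega) s c x y _ (hα.tail _)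

theorem IsMulSeries.fcomp {α β : List B → B} (hα : IsMulSeries K α) (hβ : IsMulSeries K β) :
    IsMulSeries K (fcomp α β) := fun p s c x y =>
  fcomp_lin hβ p.length p le_rfl s c x y α hα

theorem isMulSeries_one : IsMulSeries K (fmfsOne : List B → B) := by
  intro p s c x y
  cases p <;> simp [fmfsOne]

theorem isMulSeries_I : IsMulSeries K (fmfsI : List B → B) := by
  intro p s c x y
  rcases p with _ | ⟨a, _ | ⟨b, p⟩⟩ <;> cases s <;> simp [fmfsI]

theorem IsMulSeries.addf {α β : List B → B} (hα : IsMulSeries K α) (hβ : IsMulSeries K β) :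
    IsMulSeries K (fun l => α l + β l) := by
  intro p s c x y
  simp only [hα p s c x y, hβ p s c x y, smul_add]
  exact add_add_add_comm _ _ _ _

/-- Fixed points of contractive maps. -/
theorem exists_fix (Φ : (List B → B) → (List B → B))
    (hΦ : ∀ x y l, (∀ l', l'.length < l.length → x l' = y l') → Φ x l = Φ y l)
    (hm : ∀ x, IsMulSeries K x → IsMulSeries K (Φ x)) :
    ∃ x, IsMulSeries K x ∧ Φ x = x := by
  have hst : ∀ n m (l : List B), l.length < n → n ≤ m →
      Φ^[n] (fun _ => 0) l = Φ^[m] (fun _ => 0) l := by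
    intro n
    induction n with
    | zero => intro m l h; omega
    | succ n ih =>
      intro m l h hm
      obtain ⟨m, rfl⟩ : ∃ k, m = k + 1 := ⟨m - 1, by omega⟩
      rw [Function.iterate_succ_apply', Function.iterate_succ_apply']
      apply hΦ
      intro l' hl'
      exact ih m l' (by omega) (by omega)
  have hmul : ∀ n, IsMulSeries K (Φ^[n] (fun _ => (0 : B))) := by
    intro n
    induction n with
    | zero => intro p s c x y; simp
    | succ n ih => rw [Function.iterate_succ_apply']; exact hm _ ih
  refine ⟨fun l => Φ^[l.length + 1] (fun _ => 0) l, ?_, ?_⟩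
  · intro p s c x y
    have := hmul ((p ++ x :: s).length + 1) p s c x y
    simpa using this
  · funext l
    rw [Function.iterate_succ_apply']
    apply hΦ
    intro l' hl'
    exact hst _ _ _ (by omega) (by omega)

theorem exists_rinv {β : List B → B} (hβ : IsMulSeries K β) (hu : IsUnit (β [])) :
    ∃ e, IsMulSeries K e ∧ fmul β e = fmfsOne ∧ IsUnit (e []) := by
  obtain ⟨u, hu⟩ := hu
  let β' : List B → B := fun l => match l with
    | [] => 0
    | a :: t => β (a :: t)
  have hβ' : IsMulSeries K β' := by
    intro p s c x y
    cases p with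
    | nil => exact hβ [] s c x y
    | cons a p => exact hβ (a :: p) s c x y
  obtain ⟨e, he, hfix⟩ := exists_fix (K := K)
    (fun e l => (↑u⁻¹ : B) * (fmfsOne l - fmul β' e l))
    (by
      intro x y l h
      have : fmul β' x l = fmul β' y l := by
        rw [fmul_eq, fmul_eq]
        apply cv_congr
        intro w v hwv
        cases w with
        | nil => simp [β']
        | cons a w =>
          rw [h v]
          rw [← hwv]; simp
      simp only [this])
    (by
      intro x hx p s c y z
      have h1 := isMulSeries_one (K := K) p s c y z
      have h2 := hβ'.fmul hx p s c y z
      simp only [h1, h2]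
      rw [← mul_smul_comm, ← mul_add, smul_sub]
      congr 1
      abel)
  have hd : ∀ l, β [] * e l = fmfsOne l - fmul β' e l := by
    intro l
    have := congrFun hfix l
    rw [← this, ← hu, Units.mul_inv_cancel_left]
  refine ⟨e, he, ?_, ?_⟩
  · funext l
    cases l with
    | nil => rw [fmul_nil, hd, fmul_nil]; simp [β']
    | cons a t =>
      rw [fmul_cons, hd, fmul_cons]
      simp [β']
  · have := congrFun hfix []
    simp only [fmul_nil, fmfsOne, β', zero_mul, sub_zero, mul_one] at this
    rw [← this]
    exact u⁻¹.isUnit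

theorem exists_inv {β : List B → B} (hβ : IsMulSeries K β) (hu : IsUnit (β [])) :
    ∃ e, IsMulSeries K e ∧ fmul β e = fmfsOne ∧ fmul e β = fmfsOne := by
  obtain ⟨e, he, h1, h2⟩ := exists_rinv hβ hu
  obtain ⟨f, hf, h3, h4⟩ := exists_rinv he h2
  have : β = f := by
    calc β = fmul β (fmul e f) := by rw [h3]; funext l; rw [fmul_one]
      _ = f := by rw [← fmul_assoc, h1, one_fmul]
  exact ⟨e, he, h1, by rw [this, h3]⟩

theorem exists_cinv {β : List B → B} (hβ : IsMulSeries K β) (hu : IsUnit (β [])) :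
    ∃ c, IsMulSeries K c ∧ c [] = 0 ∧ fcomp (fmul fmfsI β) c = fmfsI ∧
      fcomp c (fmul fmfsI β) = fmfsI := by
  obtain ⟨e, he, h1, h2⟩ := exists_inv hβ hu
  obtain ⟨c, hc, hfix⟩ := exists_fix (K := K) (fun c => fmul fmfsI (fcomp e c))
    (by
      intro x y l h
      cases l with
      | nil => simp [fmul_I_nil]
      | cons a t =>
        simp only [fmul_I_cons]
        rw [fcomp_congr x y t.length (fun l hl => h l (by simp; omega)) t.length t le_rfl le_rfl])
    (fun x hx => isMulSeries_I.fmul (he.fcomp hx))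
  have hc0 : c [] = 0 := by rw [← hfix]; exact fmul_I_nil _
  refine ⟨c, hc, hc0, ?_, ?_⟩
  · rw [fcomp_fmul, I_fcomp c hc0]
    have h3 : fmul c (fcomp β c) = fmul (fmul fmfsI (fcomp e c)) (fcomp β c) := by rw [hfix]
    rw [h3, fmul_assoc, ← fcomp_fmul, h2, one_fcomp]
    funext l; rw [fmul_one]
  · have hx : fcomp c (fmul fmfsI β) =
        fmul (fmul fmfsI β) (fcomp e (fcomp c (fmul fmfsI β))) := by
      conv_lhs => rw [← hfix]
      rw [fcomp_fmul, I_fcomp _ (fmul_I_nil _), fcomp_assoc' he]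
    have hI : (fmfsI : List B → B) = fmul (fmul fmfsI β) (fcomp e fmfsI) := by
      have : fcomp e fmfsI = e := funext fun l => fcomp_I l e he
      rw [this, fmul_assoc, h1]
      funext l; rw [fmul_one]
    generalize fcomp c (fmul fmfsI β) = x at hx
    have key : ∀ n (l : List B), l.length ≤ n → x l = fmfsI l := by
      intro n
      induction n with
      | zero =>
        intro l hl
        obtain rfl : l = [] := by simpa using hl
        rw [hx, fmul_nil, fmul_I_nil, zero_mul]; rfl
      | succ n ih =>
        intro l hl
        cases l with
        | nil => exact ih [] (by simp)
        | cons a t =>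
          rw [hx]
          conv_rhs => rw [hI]
          rw [fmul_assoc, fmul_assoc, fmul_I_cons, fmul_I_cons, fmul_eq, fmul_eq]
          congr 1
          apply cv_congr
          intro u v huv
          have h1 := congrArg List.length huv
          simp at h1 hl
          rw [fcomp_congr x fmfsI n ih v.length v le_rfl (by omega)]
    funext l
    exact key _ l le_rfl

end Helpers


variable {K : Type*} [Field K] {B : Type*} [Ring B] [Algebra K B]

/-- Let `β ∈ Mul[[B]]` with `β₀` invertible.  Then, with `c = (Iβ)°⁻¹` the
compositional inverse of `Iβ` and `d = (1 + I)⁻¹` the multiplicative inverse of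
`1 + I`, the unsymmetrized T-transform `T̃_β = (β ∘ (Iβ)°⁻¹)(1 + I)⁻¹` is the
unique element of `Mul[[B]]` satisfying `(T̃_β ∘ (Iβ))(1 + Iβ) = β`. -/
theorem ttransform_characterization (β : List B → B) (hβ : IsMulSeries K β)
    (hu : IsUnit (β [])) :
    ∃ c d : List B → B, IsMulSeries K c ∧ IsMulSeries K d ∧ c [] = 0 ∧
      fcomp (fmul fmfsI β) c = fmfsI ∧ fcomp c (fmul fmfsI β) = fmfsI ∧
      fmul (fun l => fmfsOne l + fmfsI l) d = fmfsOne ∧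
      fmul d (fun l => fmfsOne l + fmfsI l) = fmfsOne ∧
      ∀ T : List B → B, IsMulSeries K T →
        (T = fmul (fcomp β c) d ↔
          fmul (fcomp T (fmul fmfsI β)) (fun l => fmfsOne l + fmul fmfsI β l) = β) := by
  have hI1 : IsMulSeries K (fun l : List B => fmfsOne l + fmfsI l) :=
    isMulSeries_one.addf isMulSeries_I
  obtain ⟨d, hd, hd1, hd2⟩ := exists_inv hI1 (by simp [fmfsOne, fmfsI])
  obtain ⟨c, hc, hc0, hc1, hc2⟩ := exists_cinv hβ hu
  refine ⟨c, d, hc, hd, hc0, hc1, hc2, hd1, hd2, ?_⟩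
  intro T hT
  have hI' : ∀ α : List B → B, IsMulSeries K α → fcomp α fmfsI = α :=
    fun α hα => funext fun l => fcomp_I l α hα
  have h1' : ∀ α : List B → B, fmul α fmfsOne = α := fun α => funext fun l => fmul_one l α
  have hγ : (fun l => fmfsOne l + fmul fmfsI β l) =
      fcomp (fun l => fmfsOne l + fmfsI l) (fmul fmfsI β) := by
    funext l
    rw [fcomp_add_left, one_fcomp, I_fcomp _ (fmul_I_nil _)]
  rw [hγ, ← fcomp_fmul]
  constructor
  · rintro rfl
    rw [fmul_assoc, hd2, h1', fcomp_assoc' hβ, hc2, hI' β hβ]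
  · intro h
    have h2 : fcomp (fcomp (fmul T (fun l => fmfsOne l + fmfsI l)) (fmul fmfsI β)) c =
        fcomp β c := by rw [h]
    rw [fcomp_assoc' (hT.fmul hI1), hc1, hI' _ (hT.fmul hI1)] at h2
    rw [← h2, fmul_assoc, hd1, h1']
end

section
/- Let (A, φ) be a ℂ-valued noncommutative probability space, a ∈ A with φ(a) ≠ 0, and let α = (α_0, α_1, ...) be the T-transform of the distribution series of a, i.e. the unique power series with (T(zF(z)))(1 + zF(z)) = F(z) where F(z) = ∑_{n≥0} φ(a^{n+1}) z^n and T(z) = ∑ α_n z^n. Then for every n ≥ 1, φ(a^n) = ∑_{π ∈ NCL(n)} α_0^{n - |π|} ∏_{B ∈ π} α_{|B|-1}. -/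
attribute [local instance] Classical.propDecidable

noncomputable section

/-- Two subsets `E`, `F` of `{1,...,n}` are crossing if there exist
`i₁ < j₁ < i₂ < j₂` with `i₁, i₂ ∈ E` and `j₁, j₂ ∈ F`. -/
def Crossing (E F : Finset ℕ) : Prop :=
  ∃ i₁ ∈ E, ∃ i₂ ∈ E, ∃ j₁ ∈ F, ∃ j₂ ∈ F, i₁ < j₁ ∧ j₁ < i₂ ∧ i₂ < j₂

/-- `i` is the minimum element of `E`. -/
def IsMinOf (i : ℕ) (E : Finset ℕ) : Prop := i ∈ E ∧ ∀ j ∈ E, i ≤ j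

/-- `E` and `F` are nearly disjoint. -/
def NearlyDisjoint (E F : Finset ℕ) : Prop :=
  ∀ i ∈ E ∩ F,
    (IsMinOf i E ∧ 1 < E.card ∧ ¬ IsMinOf i F) ∨
    (¬ IsMinOf i E ∧ IsMinOf i F ∧ 1 < F.card)

/-- `π` is a noncrossing linked partition of `{1,...,n}`. -/
def IsNCL (n : ℕ) (π : Finset (Finset ℕ)) : Prop :=
  (∀ E ∈ π, E.Nonempty) ∧ π.biUnion id = Finset.Icc 1 n ∧
    ∀ E ∈ π, ∀ F ∈ π, E ≠ F → ¬ Crossing E F ∧ NearlyDisjoint E F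

/-- `π` is a noncrossing partition of `{1,...,n}`. -/
def IsNC (n : ℕ) (π : Finset (Finset ℕ)) : Prop :=
  (∀ E ∈ π, E.Nonempty) ∧ π.biUnion id = Finset.Icc 1 n ∧
    ∀ E ∈ π, ∀ F ∈ π, E ≠ F → Disjoint E F ∧ ¬ Crossing E F

/-- The order on (linked) partitions: every block of `π` is contained in a block of `σ`. -/
def NCLle (π σ : Finset (Finset ℕ)) : Prop := ∀ E ∈ π, ∃ E' ∈ σ, E ⊆ E'

/-- The finset of all noncrossing linked partitions of `{1,...,n}`. -/
def NCLset (n : ℕ) : Finset (Finset (Finset ℕ)) :=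
  ((Finset.Icc 1 n).powerset.powerset).filter (IsNCL n)

/-- The finset of all noncrossing partitions of `{1,...,n}`. -/
def NCset (n : ℕ) : Finset (Finset (Finset ℕ)) :=
  ((Finset.Icc 1 n).powerset.powerset).filter (IsNC n)

/-! ### Series part -/

/-- Sum over compositions with shifted index. -/
def CC (α m : ℕ → ℂ) (j : ℕ) {X : Type*} (l : List X) : ℂ :=
  ((comps l).map fun c => α (j + c.length) * (c.map fun b => m b.length).prod).sum

/-- Weight of a composition, first block weighted by `g`. -/
def QW (α m : ℕ → ℂ) (j : ℕ) (g : ℕ → ℂ) {X : Type*} : List (List X) → ℂ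
  | [] => 0
  | b :: bs => g b.length * (α (j + 1 + bs.length) * (bs.map fun b => m b.length).prod)

lemma sum_filterMap_aux {X Y : Type*} (L : List X) (f : X → Option Y) (g : Y → ℂ) :
    ((L.filterMap f).map g).sum = (L.map fun c => ((f c).map g).getD 0).sum := by
  induction L with
  | nil => rfl
  | cons x L ih =>
    rw [List.filterMap_cons]
    cases h : f x <;> simp [h, ih]

lemma QW_sum (α m : ℕ → ℂ) (j : ℕ) {X : Type*} (l : List X) : ∀ g : ℕ → ℂ,
    ((comps l).map (QW α m j g)).sum =
      ∑ i ∈ Finset.range l.length, g (i + 1) * CC α m (j + 1) (l.drop (i + 1)) := by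
  induction l with
  | nil => intro g; simp [comps, QW]
  | cons a t ih =>
    intro g
    have h1 : ((comps (a :: t)).map (QW α m j g)).sum =
        g 1 * CC α m (j + 1) t + ((comps t).map (QW α m j fun k => g (k + 1))).sum := by
      rw [comps, List.map_append, List.sum_append, sum_filterMap_aux, CC, ← List.sum_map_mul_left,
        List.map_map]
      congr 2
      apply List.map_congr_left
      intro c _
      cases c <;> simp [QW]
    rw [h1, ih, List.length_cons, Finset.sum_range_succ']
    simp only [List.drop_succ_cons, List.drop_zero, zero_add]
    ring

lemma comps_ne_nil {X : Type*} (a : X) (t : List X) (c) (hc : c ∈ comps (a :: t)) : c ≠ [] := by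
  rw [comps] at hc
  simp only [List.mem_append, List.mem_map, List.mem_filterMap] at hc
  rcases hc with ⟨d, _, rfl⟩ | ⟨d, _, h⟩
  · simp
  · cases d with
    | nil => simp at h
    | cons b bs => simp at h; rw [← h]; simp

lemma CC_cons (α m : ℕ → ℂ) (j : ℕ) {X : Type*} (a : X) (t : List X) :
    CC α m j (a :: t) = ∑ i ∈ Finset.range (t.length + 1),
      m (i + 1) * CC α m (j + 1) (t.drop i) := by
  have := QW_sum α m j (a :: t) m
  simp only [List.length_cons, List.drop_succ_cons] at this
  rw [← this, CC]
  congr 1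
  apply List.map_congr_left
  intro c hc
  have := comps_ne_nil a t c hc
  cases c with
  | nil => exact absurd rfl this
  | cons b bs =>
    simp only [QW, List.length_cons, List.map_cons, List.prod_cons]
    rw [show j + (bs.length + 1) = j + 1 + bs.length by ring]
    ring

def Cn (α m : ℕ → ℂ) (j n : ℕ) : ℂ := CC α m j (List.replicate n (1 : ℂ))

lemma Cn_zero (α m : ℕ → ℂ) (j : ℕ) : Cn α m j 0 = α j := by
  simp [Cn, CC, comps]

lemma Cn_succ (α m : ℕ → ℂ) (j n : ℕ) :
    Cn α m j (n + 1) = ∑ p ∈ Finset.HasAntidiagonal.antidiagonal n, m (p.1 + 1) * Cn α m (j + 1) p.2 := by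
  rw [Cn, List.replicate_succ, CC_cons, Finset.Nat.sum_antidiagonal_eq_sum_range_succ_mk]
  simp [Cn]

def Dn (α m : ℕ → ℂ) (j n : ℕ) : ℂ := ∑ p ∈ Finset.HasAntidiagonal.antidiagonal n, Cn α m j p.1 * m p.2

lemma Dn_zero (α m : ℕ → ℂ) (j : ℕ) : Dn α m j 0 = α j * m 0 := by
  simp [Dn, Cn_zero]

lemma Dn_succ (α m : ℕ → ℂ) (j n : ℕ) :
    Dn α m j (n + 1) = α j * m (n + 1) +
      ∑ p ∈ Finset.HasAntidiagonal.antidiagonal n, m (p.1 + 1) * Dn α m (j + 1) p.2 := by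
  have hc : PowerSeries.mk (Cn α m j) = PowerSeries.C (α j) +
      PowerSeries.X * (PowerSeries.mk (fun k => m (k + 1)) * PowerSeries.mk (Cn α m (j + 1))) := by
    ext k
    cases k with
    | zero => simp [Cn_zero]
    | succ k =>
      rw [map_add, PowerSeries.coeff_succ_X_mul, PowerSeries.coeff_mk, Cn_succ,
        PowerSeries.coeff_mul, PowerSeries.coeff_C]
      simp
  have hD : ∀ j, PowerSeries.mk (Dn α m j) =
      PowerSeries.mk (Cn α m j) * PowerSeries.mk m := by
    intro j; ext k; simp [Dn, PowerSeries.coeff_mul]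
  have h : PowerSeries.mk (Dn α m j) = PowerSeries.C (α j) * PowerSeries.mk m +
      PowerSeries.X * (PowerSeries.mk (fun k => m (k + 1)) * PowerSeries.mk (Dn α m (j + 1))) := by
    rw [hD, hD, hc]; ring
  have := congrArg (PowerSeries.coeff (n + 1)) h
  rw [map_add, PowerSeries.coeff_succ_X_mul, PowerSeries.coeff_C_mul,
    PowerSeries.coeff_mul] at this
  simpa using this

lemma fmulI_nil (F : List ℂ → ℂ) : fmul fmfsI F [] = 0 := by
  simp [fmul, fmfsI]

lemma fmulI_cons (F : List ℂ → ℂ) (x : ℂ) (t : List ℂ) : fmul fmfsI F (x :: t) = x * F t := by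
  rw [fmul, Finset.sum_eq_single 1]
  · simp [fmfsI]
  · intro i hi h1
    simp only [Finset.mem_range, List.length_cons] at hi
    have : fmfsI (List.take i (x :: t)) = 0 := by
      rcases i with _ | _ | i
      · simp [fmfsI]
      · exact absurd rfl h1
      · cases t with
        | nil => simp at hi
        | cons y t => simp [fmfsI]
    rw [this, zero_mul]
  · intro h; simp at h

lemma comps_parts {X : Type*} (l : List X) : ∀ c ∈ comps l, ∀ b ∈ c, b ≠ [] ∧ ∀ x ∈ b, x ∈ l := by
  induction l with
  | nil => intro c hc b hb; simp [comps] at hc; subst hc; simp at hb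
  | cons a t ih =>
    intro c hc b hb
    rw [comps] at hc
    simp only [List.mem_append, List.mem_map, List.mem_filterMap] at hc
    rcases hc with ⟨d, hd, rfl⟩ | ⟨d, hd, h⟩
    · rcases List.mem_cons.1 hb with rfl | hb
      · simp
      · exact ⟨(ih d hd b hb).1, fun x hx => List.mem_cons_of_mem _ ((ih d hd b hb).2 x hx)⟩
    · cases d with
      | nil => simp at h
      | cons e es =>
        simp at h; subst h
        rcases List.mem_cons.1 hb with rfl | hb
        · refine ⟨by simp, fun x hx => ?_⟩
          rcases List.mem_cons.1 hx with rfl | hx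
          · simp
          · exact List.mem_cons_of_mem _ ((ih _ hd e (by simp)).2 x hx)
        · exact ⟨(ih _ hd b (by simp [hb])).1,
            fun x hx => List.mem_cons_of_mem _ ((ih _ hd b (by simp [hb])).2 x hx)⟩

lemma series_rec (m α : ℕ → ℂ) (hm0 : m 0 = 1)
    (hT : fmul
        (fcomp (fun l : List ℂ => α l.length * l.prod)
          (fmul fmfsI (fun l : List ℂ => m (l.length + 1) * l.prod)))
        (fun l : List ℂ =>
          fmfsOne l + fmul fmfsI (fun l' : List ℂ => m (l'.length + 1) * l'.prod) l)
      = fun l : List ℂ => m (l.length + 1) * l.prod) (n : ℕ) :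
    Dn α m 0 n = m (n + 1) := by
  have h := congrFun hT (List.replicate n 1)
  have e : m (n + 1) = (fun l : List ℂ => m (l.length + 1) * l.prod) (List.replicate n 1) := by
    simp
  rw [e]; refine Eq.trans ?_ h; rw [fmul, Dn, Finset.Nat.sum_antidiagonal_eq_sum_range_succ_mk]
  rw [List.length_replicate]
  apply Finset.sum_congr rfl
  intro i hi
  have hi : i ≤ n := by simpa [Nat.lt_succ_iff] using hi
  congr 1
  · rw [List.take_replicate, min_eq_left hi, fcomp, Cn, CC]
    congr 1
    apply List.map_congr_left
    intro c hc
    simp only [List.length_map, zero_add]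
    congr 2
    apply List.map_congr_left
    intro b hb
    obtain ⟨h1, h2⟩ := comps_parts _ c hc b hb
    have h3 : b = List.replicate b.length 1 :=
      List.eq_replicate_iff.2 ⟨rfl, fun x hx => List.eq_of_mem_replicate (h2 x hx)⟩
    obtain ⟨k, hk⟩ : ∃ k, b.length = k + 1 := ⟨b.length - 1, by
      have := List.length_pos_iff.2 h1; omega⟩
    rw [hk] at h3
    rw [hk, h3, List.replicate_succ, fmulI_cons]
    simp
  · rw [List.drop_replicate]
    cases h : n - i with
    | zero => simp [fmulI_nil, fmfsOne, h, hm0]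
    | succ k =>
      simp only
      rw [List.replicate_succ, fmulI_cons]
      simp [fmfsOne, h]

/-! ### Forest part -/

/-- Arc sets of noncrossing increasing forests on `[s,t)`. -/
def IsFor (s t : ℕ) (A : Finset (ℕ × ℕ)) : Prop :=
  (∀ a b, (a, b) ∈ A → s ≤ a ∧ a < b ∧ b < t) ∧
  (∀ a a' b, (a, b) ∈ A → (a', b) ∈ A → a = a') ∧
  (∀ a b c d, (a, c) ∈ A → (b, d) ∈ A → a < b → b < c → c < d → False)

def Fors (s t : ℕ) : Finset (Finset (ℕ × ℕ)) :=
  ((Finset.Ico s t ×ˢ Finset.Ico s t).powerset).filter (IsFor s t)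

lemma mem_Fors {s t : ℕ} {A : Finset (ℕ × ℕ)} : A ∈ Fors s t ↔ IsFor s t A := by
  rw [Fors, Finset.mem_filter, Finset.mem_powerset, and_iff_right_iff_imp]
  rintro h ⟨a, b⟩ hab
  have := h.1 a b hab
  simp only [Finset.mem_product, Finset.mem_Ico]
  omega

def chil (A : Finset (ℕ × ℕ)) (i : ℕ) : Finset ℕ := (A.filter (fun p => p.1 = i)).image Prod.snd

lemma mem_chil {A : Finset (ℕ × ℕ)} {i b : ℕ} : b ∈ chil A i ↔ (i, b) ∈ A := by
  simp [chil]

def dg (A : Finset (ℕ × ℕ)) (i : ℕ) : ℕ := (chil A i).card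

lemma dg_eq_zero {A : Finset (ℕ × ℕ)} {i : ℕ} (h : ∀ b, (i, b) ∉ A) : dg A i = 0 := by
  rw [dg, Finset.card_eq_zero, Finset.eq_empty_iff_forall_notMem]
  intro b hb
  exact h b (mem_chil.1 hb)

lemma dg_congr {A A' : Finset (ℕ × ℕ)} {i : ℕ} (h : ∀ b, (i, b) ∈ A ↔ (i, b) ∈ A') :
    dg A i = dg A' i := by
  unfold dg
  congr 1
  ext b
  rw [mem_chil, mem_chil, h]

def MM (α : ℕ → ℂ) (s t : ℕ) : ℂ := ∑ A ∈ Fors s t, ∏ i ∈ Finset.Ico s t, α (dg A i)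

def PP (α : ℕ → ℂ) (j s t : ℕ) : ℂ :=
  ∑ A ∈ Fors s t, α (j + dg A s) * ∏ i ∈ Finset.Ico (s + 1) t, α (dg A i)

lemma MM_self (α : ℕ → ℂ) (s : ℕ) : MM α s s = 1 := by
  have : Fors s s = {∅} := by
    ext A
    rw [mem_Fors, Finset.mem_singleton]
    constructor
    · intro h
      rw [Finset.eq_empty_iff_forall_notMem]
      rintro ⟨a, b⟩ hab
      have := h.1 a b hab
      omega
    · rintro rfl
      simp [IsFor]
  simp [MM, this]

lemma MM_eq_PP (α : ℕ → ℂ) {s t : ℕ} (h : s < t) : MM α s t = PP α 0 s t := by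
  unfold MM PP
  apply Finset.sum_congr rfl
  intro A _
  rw [Finset.prod_eq_prod_Ico_succ_bot h, zero_add]

/-- largest child of `s`, or `s` -/
def topc (s : ℕ) (A : Finset (ℕ × ℕ)) : ℕ := (chil A s).sup id ⊔ s

lemma topc_le {s b : ℕ} {A : Finset (ℕ × ℕ)} (h : (s, b) ∈ A) : b ≤ topc s A :=
  le_trans (Finset.le_sup (f := id) (mem_chil.2 h)) le_sup_left

lemma topc_mem {s : ℕ} {A : Finset (ℕ × ℕ)} (h : topc s A ≠ s) : (s, topc s A) ∈ A := by
  unfold topc at *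
  have h1 : s < (chil A s).sup id := by
    by_contra hc
    exact h (sup_eq_right.2 (not_lt.1 hc))
  rw [sup_eq_left.2 h1.le]
  have hne : (chil A s).Nonempty := by
    by_contra hc
    rw [Finset.not_nonempty_iff_eq_empty] at hc
    rw [hc] at h1
    simp at h1
  obtain ⟨b, hb, e⟩ := Finset.exists_mem_eq_sup _ hne id
  rw [e]
  exact mem_chil.1 hb

lemma topc_eq {s c : ℕ} {A : Finset (ℕ × ℕ)} (h : (s, c) ∈ A) (hs : s ≤ c)
    (hm : ∀ b, (s, b) ∈ A → b ≤ c) : topc s A = c := by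
  apply le_antisymm _ (topc_le h)
  unfold topc
  exact sup_le (Finset.sup_le fun b hb => hm b (mem_chil.1 hb)) hs

def spl1 (c : ℕ) (A : Finset (ℕ × ℕ)) := A.filter (fun p => p.2 < c)
def spl2 (c : ℕ) (A : Finset (ℕ × ℕ)) := A.filter (fun p => c ≤ p.1)
def gl (s c : ℕ) (A B : Finset (ℕ × ℕ)) := insert (s, c) (A ∪ B)

lemma mem_spl1 {c a b : ℕ} {A : Finset (ℕ × ℕ)} : (a, b) ∈ spl1 c A ↔ (a, b) ∈ A ∧ b < c := by
  simp [spl1]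
lemma mem_spl2 {c a b : ℕ} {A : Finset (ℕ × ℕ)} : (a, b) ∈ spl2 c A ↔ (a, b) ∈ A ∧ c ≤ a := by
  simp [spl2]
lemma mem_gl {s c a b : ℕ} {A B : Finset (ℕ × ℕ)} :
    (a, b) ∈ gl s c A B ↔ (a = s ∧ b = c) ∨ (a, b) ∈ A ∨ (a, b) ∈ B := by
  simp [gl]

lemma fib_zero (α : ℕ → ℂ) (j s t : ℕ) (hst : s < t) :
    ∑ A ∈ Fors s t with topc s A = s,
      α (j + dg A s) * ∏ i ∈ Finset.Ico (s + 1) t, α (dg A i) = α j * MM α (s + 1) t := by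
  have : (Fors s t).filter (fun A => topc s A = s) = Fors (s + 1) t := by
    ext A
    rw [Finset.mem_filter, mem_Fors, mem_Fors]
    constructor
    · rintro ⟨h, ht⟩
      refine ⟨fun a b hab => ?_, h.2⟩
      have h1 := h.1 a b hab
      rcases eq_or_lt_of_le h1.1 with rfl | h2
      · have := topc_le hab; omega
      · omega
    · intro h
      refine ⟨⟨fun a b hab => ?_, h.2⟩, ?_⟩
      · have := h.1 a b hab; omega
      · by_contra hc
        have := h.1 _ _ (topc_mem hc)
        omega
  rw [this, MM, Finset.mul_sum]
  apply Finset.sum_congr rfl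
  intro A hA
  rw [mem_Fors] at hA
  rw [dg_eq_zero (i := s), add_zero]
  intro b hb
  have := hA.1 _ _ hb
  omega

lemma fib_pos (α : ℕ → ℂ) (j s c t : ℕ) (hsc : s < c) (hct : c < t) :
    ∑ A ∈ Fors s t with topc s A = c,
      α (j + dg A s) * ∏ i ∈ Finset.Ico (s + 1) t, α (dg A i)
      = PP α (j + 1) s c * MM α c t := by
  rw [PP, MM, Finset.sum_mul_sum, ← Finset.sum_product']
  symm
  refine Finset.sum_bij' (fun p _ => gl s c p.1 p.2) (fun A _ => (spl1 c A, spl2 c A))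
    ?_ ?_ ?_ ?_ ?_
  · rintro ⟨A, B⟩ h
    simp only [Finset.mem_product, mem_Fors] at h
    obtain ⟨⟨a1, a2, a3⟩, ⟨b1, b2, b3⟩⟩ := h
    simp only [Finset.mem_filter, mem_Fors]
    refine ⟨⟨?_, ?_, ?_⟩, ?_⟩
    · intro a b h
      rcases mem_gl.1 h with h | h | h
      · omega
      · have := a1 _ _ h; omega
      · have := b1 _ _ h; omega
    · intro a a' b h h'
      rcases mem_gl.1 h with h | h | h <;> rcases mem_gl.1 h' with h' | h' | h'
      · omega
      · have := a1 _ _ h'; omega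
      · have := b1 _ _ h'; omega
      · have := a1 _ _ h; omega
      · exact a2 _ _ _ h h'
      · have := a1 _ _ h; have := b1 _ _ h'; omega
      · have := b1 _ _ h; omega
      · have := a1 _ _ h'; have := b1 _ _ h; omega
      · exact b2 _ _ _ h h'
    · intro a b x d h h' l1 l2 l3
      rcases mem_gl.1 h with h | h | h <;> rcases mem_gl.1 h' with h' | h' | h'
      · omega
      · have := a1 _ _ h'; omega
      · have := b1 _ _ h'; omega
      · have := a1 _ _ h; omega
      · exact a3 _ _ _ _ h h' l1 l2 l3
      · have := a1 _ _ h; have := b1 _ _ h'; omega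
      · have := b1 _ _ h; omega
      · have := a1 _ _ h'; have := b1 _ _ h; omega
      · exact b3 _ _ _ _ h h' l1 l2 l3
    · apply topc_eq (mem_gl.2 (Or.inl ⟨rfl, rfl⟩)) hsc.le
      intro b h
      rcases mem_gl.1 h with h | h | h
      · omega
      · have := a1 _ _ h; omega
      · have := b1 _ _ h; omega
  · intro A h
    simp only [Finset.mem_filter, mem_Fors] at h
    obtain ⟨⟨a1, a2, a3⟩, ht⟩ := h
    simp only [Finset.mem_product, mem_Fors]
    refine ⟨⟨?_, ?_, ?_⟩, ⟨?_, ?_, ?_⟩⟩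
    · intro a b h
      have h := mem_spl1.1 h
      have := a1 _ _ h.1
      omega
    · intro a a' b h h'
      exact a2 _ _ _ (mem_spl1.1 h).1 (mem_spl1.1 h').1
    · intro a b x d h h'
      exact a3 _ _ _ _ (mem_spl1.1 h).1 (mem_spl1.1 h').1
    · intro a b h
      have h := mem_spl2.1 h
      have := a1 _ _ h.1
      omega
    · intro a a' b h h'
      exact a2 _ _ _ (mem_spl2.1 h).1 (mem_spl2.1 h').1
    · intro a b x d h h'
      exact a3 _ _ _ _ (mem_spl2.1 h).1 (mem_spl2.1 h').1
  · rintro ⟨A, B⟩ h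
    simp only [Finset.mem_product, mem_Fors] at h
    obtain ⟨⟨a1, a2, a3⟩, ⟨b1, b2, b3⟩⟩ := h
    simp only [Prod.mk.injEq]
    constructor
    · ext ⟨a, b⟩
      rw [mem_spl1, mem_gl]
      constructor
      · rintro ⟨h | h | h, h'⟩
        · omega
        · exact h
        · have := b1 _ _ h; omega
      · intro h
        have := a1 _ _ h
        exact ⟨Or.inr (Or.inl h), by omega⟩
    · ext ⟨a, b⟩
      rw [mem_spl2, mem_gl]
      constructor
      · rintro ⟨h | h | h, h'⟩
        · omega
        · have := a1 _ _ h; omega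
        · exact h
      · intro h
        have := b1 _ _ h
        exact ⟨Or.inr (Or.inr h), by omega⟩
  · intro A h
    simp only [Finset.mem_filter, mem_Fors] at h
    obtain ⟨⟨a1, a2, a3⟩, ht⟩ := h
    have hc : (s, c) ∈ A := by
      have := topc_mem (s := s) (A := A) (by omega)
      rwa [ht] at this
    ext ⟨a, b⟩
    simp only [mem_gl, mem_spl1, mem_spl2]
    constructor
    · rintro (⟨rfl, rfl⟩ | h | h)
      · exact hc
      · exact h.1
      · exact h.1
    · intro h
      rcases lt_trichotomy b c with hb | rfl | hb
      · exact Or.inr (Or.inl ⟨h, hb⟩)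
      · exact Or.inl ⟨a2 _ _ _ h hc, rfl⟩
      · refine Or.inr (Or.inr ⟨h, ?_⟩)
        have h1 := a1 _ _ h
        rcases eq_or_lt_of_le h1.1 with rfl | h2
        · have := topc_le h; omega
        · by_contra hlt
          exact a3 _ _ _ _ hc h h2 (by omega) hb
  · rintro ⟨A, B⟩ h
    simp only [Finset.mem_product, mem_Fors] at h
    obtain ⟨⟨a1, a2, a3⟩, ⟨b1, b2, b3⟩⟩ := h
    simp only
    have hs : dg (gl s c A B) s = dg A s + 1 := by
      have hn : c ∉ chil A s := by
        intro h
        have := a1 _ _ (mem_chil.1 h); omega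
      rw [dg, dg, ← Finset.card_insert_of_notMem hn]
      congr 1
      ext b
      rw [mem_chil, mem_gl, Finset.mem_insert, mem_chil]
      constructor
      · rintro (h | h | h)
        · exact Or.inl h.2
        · exact Or.inr h
        · have := b1 _ _ h; omega
      · rintro (h | h)
        · exact Or.inl ⟨rfl, h⟩
        · exact Or.inr (Or.inl h)
    rw [hs, ← Finset.prod_Ico_consecutive _ (show s + 1 ≤ c by omega) hct.le,
      show j + 1 + dg A s = j + (dg A s + 1) by ring, mul_assoc]
    congr 2
    · apply Finset.prod_congr rfl
      intro i hi
      rw [Finset.mem_Ico] at hi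
      congr 1
      apply dg_congr
      intro b
      rw [mem_gl]
      constructor
      · exact fun h => Or.inr (Or.inl h)
      · rintro (h | h | h)
        · omega
        · exact h
        · have := b1 _ _ h; omega
    · apply Finset.prod_congr rfl
      intro i hi
      rw [Finset.mem_Ico] at hi
      congr 1
      apply dg_congr
      intro b
      rw [mem_gl]
      constructor
      · exact fun h => Or.inr (Or.inr h)
      · rintro (h | h | h)
        · omega
        · have := a1 _ _ h; omega
        · exact h

lemma PP_rec (α : ℕ → ℂ) (j s t : ℕ) (hst : s < t) :
    PP α j s t = α j * MM α (s + 1) t +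
      ∑ c ∈ Finset.Ico (s + 1) t, PP α (j + 1) s c * MM α c t := by
  have hmap : ∀ A ∈ Fors s t, topc s A ∈ Finset.Ico s t := by
    intro A hA
    rw [mem_Fors] at hA
    rw [Finset.mem_Ico]
    by_cases h : topc s A = s
    · omega
    · have := hA.1 _ _ (topc_mem h)
      omega
  rw [PP, ← Finset.sum_fiberwise_of_maps_to hmap, Finset.sum_eq_sum_Ico_succ_bot hst,
    fib_zero α j s t hst]
  congr 1
  apply Finset.sum_congr rfl
  intro c hc
  rw [Finset.mem_Ico] at hc
  exact fib_pos α j s c t (by omega) hc.2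

lemma forest_eq (m α : ℕ → ℂ) (hm0 : m 0 = 1) (h : ∀ n, Dn α m 0 n = m (n + 1)) (n : ℕ) :
    (∀ s, MM α s (s + n) = m n) ∧ ∀ j s, PP α j s (s + n + 1) = Dn α m j n := by
  induction n using Nat.strong_induction_on with
  | _ n ih =>
    have hM : ∀ s, MM α s (s + n) = m n := by
      intro s
      cases n with
      | zero => rw [add_zero, MM_self, hm0]
      | succ k =>
        rw [MM_eq_PP α (by omega), ← h, ← (ih k (by omega)).2 0 s]
        rfl
    refine ⟨hM, fun j s => ?_⟩
    rw [PP_rec α j s _ (by omega), show s + n + 1 = s + 1 + n by ring, hM]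
    cases n with
    | zero => simp [Dn_zero]
    | succ k =>
      rw [Dn_succ]
      congr 1
      rw [← Finset.Nat.sum_antidiagonal_swap (f := fun p => m (p.1 + 1) * Dn α m (j + 1) p.2),
        Finset.Nat.sum_antidiagonal_eq_sum_range_succ_mk,
        Finset.sum_Ico_eq_sum_range, show s + 1 + (k + 1) - (s + 1) = k + 1 by omega]
      apply Finset.sum_congr rfl
      intro i hi
      rw [Finset.mem_range] at hi
      have h1 := (ih i (by omega)).2 (j + 1) s
      have h2 : MM α (s + 1 + i) (s + 1 + i + (k - i + 1)) = m (k - i + 1) := by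
        rcases Nat.eq_zero_or_pos i with rfl | hpos
        · exact hM _
        · exact (ih (k - i + 1) (by omega)).1 (s + 1 + i)
      rw [show s + 1 + i = s + i + 1 by ring] at *
      rw [show s + i + 1 + (k - i + 1) = s + 1 + (k + 1) by omega] at h2
      rw [h1, h2]
      simp only [Prod.fst_swap, Prod.snd_swap, Prod.swap]
      ring

/-! ### Bijection -/

def isrt (A : Finset (ℕ × ℕ)) (i : ℕ) : Prop := (∃ b, (i, b) ∈ A) ∨ ¬ ∃ a, (a, i) ∈ A

def mins (n : ℕ) (A : Finset (ℕ × ℕ)) : Finset ℕ := (Finset.Icc 1 n).filter (isrt A)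

def blk (A : Finset (ℕ × ℕ)) (i : ℕ) : Finset ℕ := insert i (chil A i)

def blks (n : ℕ) (A : Finset (ℕ × ℕ)) : Finset (Finset ℕ) := (mins n A).image (blk A)

def arcs (n : ℕ) (π : Finset (Finset ℕ)) : Finset (ℕ × ℕ) :=
  (Finset.Icc 1 n ×ˢ Finset.Icc 1 n).filter
    (fun p => p.1 < p.2 ∧ ∃ E ∈ π, IsMinOf p.1 E ∧ p.2 ∈ E)

lemma mem_blk {A : Finset (ℕ × ℕ)} {i b : ℕ} : b ∈ blk A i ↔ b = i ∨ (i, b) ∈ A := by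
  rw [blk, Finset.mem_insert, mem_chil]

lemma isMin_unique {i j : ℕ} {E : Finset ℕ} (h : IsMinOf i E) (h' : IsMinOf j E) : i = j :=
  le_antisymm (h.2 _ h'.1) (h'.2 _ h.1)

lemma exists_min {E : Finset ℕ} (h : E.Nonempty) : ∃ i, IsMinOf i E :=
  ⟨E.min' h, E.min'_mem h, fun j hj => E.min'_le j hj⟩

lemma blk_min {s t : ℕ} {A : Finset (ℕ × ℕ)} (h : IsFor s t A) (i : ℕ) : IsMinOf i (blk A i) := by
  refine ⟨mem_blk.2 (Or.inl rfl), fun j hj => ?_⟩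
  rcases mem_blk.1 hj with rfl | hj
  · exact le_rfl
  · exact (h.1 _ _ hj).2.1.le

lemma blk_card {s t : ℕ} {A : Finset (ℕ × ℕ)} (h : IsFor s t A) (i : ℕ) :
    (blk A i).card = dg A i + 1 := by
  rw [blk, Finset.card_insert_of_notMem, dg]
  intro hc
  have := h.1 _ _ (mem_chil.1 hc)
  omega

lemma blk_inj {s t : ℕ} {A : Finset (ℕ × ℕ)} (h : IsFor s t A) {i j : ℕ}
    (e : blk A i = blk A j) : i = j :=
  isMin_unique (blk_min h i) (e ▸ blk_min h j)

lemma mem_NCLset {n : ℕ} {π : Finset (Finset ℕ)} : π ∈ NCLset n ↔ IsNCL n π := by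
  rw [NCLset, Finset.mem_filter, Finset.mem_powerset, and_iff_right_iff_imp]
  rintro h E hE
  rw [Finset.mem_powerset, ← h.2.1]
  intro x hx
  exact Finset.mem_biUnion.2 ⟨E, hE, hx⟩

lemma mem_arcs {n : ℕ} {π : Finset (Finset ℕ)} (h : IsNCL n π) {a b : ℕ} :
    (a, b) ∈ arcs n π ↔ a < b ∧ ∃ E ∈ π, IsMinOf a E ∧ b ∈ E := by
  rw [arcs, Finset.mem_filter, and_iff_right_iff_imp]
  rintro ⟨_, E, hE, h1, h2⟩
  rw [Finset.mem_product, ← h.2.1]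
  exact ⟨Finset.mem_biUnion.2 ⟨E, hE, h1.1⟩, Finset.mem_biUnion.2 ⟨E, hE, h2⟩⟩

/-- distinct blocks have distinct minima -/
lemma ncl_min {n : ℕ} {π : Finset (Finset ℕ)} (h : IsNCL n π) {i : ℕ} {E F : Finset ℕ}
    (hE : E ∈ π) (hF : F ∈ π) (h1 : IsMinOf i E) (h2 : IsMinOf i F) : E = F := by
  by_contra hne
  rcases (h.2.2 E hE F hF hne).2 i (Finset.mem_inter.2 ⟨h1.1, h2.1⟩) with h3 | h3
  · exact h3.2.2 h2
  · exact h3.1 h1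

lemma arcs_isFor {n : ℕ} {π : Finset (Finset ℕ)} (h : IsNCL n π) : IsFor 1 (n + 1) (arcs n π) := by
  refine ⟨?_, ?_, ?_⟩
  · intro a b hab
    have h1 := (mem_arcs h).1 hab
    rw [arcs, Finset.mem_filter, Finset.mem_product, Finset.mem_Icc, Finset.mem_Icc] at hab
    simp only at hab
    omega
  · intro a a' b hab hab'
    obtain ⟨l, E, hE, h1, h2⟩ := (mem_arcs h).1 hab
    obtain ⟨l', F, hF, h1', h2'⟩ := (mem_arcs h).1 hab'
    by_cases hEF : E = F
    · subst hEF; exact isMin_unique h1 h1'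
    · exfalso
      rcases (h.2.2 E hE F hF hEF).2 b (Finset.mem_inter.2 ⟨h2, h2'⟩) with h3 | h3
      · have := isMin_unique h1 h3.1; omega
      · have := isMin_unique h1' h3.2.1; omega
  · intro a b c d hac hbd l1 l2 l3
    obtain ⟨l, E, hE, h1, h2⟩ := (mem_arcs h).1 hac
    obtain ⟨l', F, hF, h1', h2'⟩ := (mem_arcs h).1 hbd
    have hEF : E ≠ F := by
      rintro rfl
      have := isMin_unique h1 h1'; omega
    exact (h.2.2 E hE F hF hEF).1 ⟨a, h1.1, c, h2, b, h1'.1, d, h2', l1, l2, l3⟩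

lemma blks_isNCL {n : ℕ} {A : Finset (ℕ × ℕ)} (h : IsFor 1 (n + 1) A) : IsNCL n (blks n A) := by
  refine ⟨?_, ?_, ?_⟩
  · intro E hE
    obtain ⟨i, _, rfl⟩ := Finset.mem_image.1 hE
    exact ⟨i, mem_blk.2 (Or.inl rfl)⟩
  · ext x
    rw [Finset.mem_biUnion]
    constructor
    · rintro ⟨E, hE, hx⟩
      obtain ⟨i, hi, rfl⟩ := Finset.mem_image.1 hE
      rcases mem_blk.1 hx with rfl | hx
      · exact (Finset.mem_filter.1 hi).1
      · have := h.1 _ _ hx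
        rw [Finset.mem_Icc]; omega
    · intro hx
      by_cases hr : ∃ a, (a, x) ∈ A
      · obtain ⟨a, ha⟩ := hr
        have h1 := h.1 _ _ ha
        refine ⟨blk A a, Finset.mem_image_of_mem _ (Finset.mem_filter.2 ⟨?_, Or.inl ⟨x, ha⟩⟩),
          mem_blk.2 (Or.inr ha)⟩
        rw [Finset.mem_Icc]; omega
      · exact ⟨blk A x, Finset.mem_image_of_mem _ (Finset.mem_filter.2 ⟨hx, Or.inr hr⟩),
          mem_blk.2 (Or.inl rfl)⟩
  · intro E hE F hF hne
    obtain ⟨i, hi, rfl⟩ := Finset.mem_image.1 hE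
    obtain ⟨j, hj, rfl⟩ := Finset.mem_image.1 hF
    have hij : i ≠ j := fun e => hne (by rw [e])
    have hi := (Finset.mem_filter.1 hi).2
    have hj := (Finset.mem_filter.1 hj).2
    have key : ∀ k x, isrt A k → (x, k) ∈ A → 1 < (blk A k).card := by
      intro k x hk hx
      rcases hk with ⟨b, hb⟩ | hk
      · rw [blk_card h]
        have : 0 < dg A k := Finset.card_pos.2 ⟨b, mem_chil.2 hb⟩
        omega
      · exact absurd ⟨x, hx⟩ hk
    constructor
    · rintro ⟨i₁, hi₁, i₂, hi₂, j₁, hj₁, j₂, hj₂, l1, l2, l3⟩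
      have m1 := (blk_min h i).2 _ hi₁
      have m2 := (blk_min h j).2 _ hj₁
      have hi2 : (i, i₂) ∈ A := (mem_blk.1 hi₂).resolve_left (by omega)
      have hj2 : (j, j₂) ∈ A := (mem_blk.1 hj₂).resolve_left (by omega)
      rcases lt_or_gt_of_ne hij with hlt | hlt
      · exact h.2.2 i j i₂ j₂ hi2 hj2 hlt (by omega) l3
      · have hj1 : (j, j₁) ∈ A := (mem_blk.1 hj₁).resolve_left (by omega)
        exact h.2.2 j i j₁ i₂ hj1 hi2 hlt (by omega) l2
    · intro x hx
      rw [Finset.mem_inter] at hx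
      rcases mem_blk.1 hx.1 with rfl | h1 <;> rcases mem_blk.1 hx.2 with e | h2
      · exact absurd e hij
      · exact Or.inl ⟨blk_min h x, key _ _ hi h2, fun hc => hij (isMin_unique hc (blk_min h j))⟩
      · subst e
        exact Or.inr ⟨fun hc => hij (isMin_unique (blk_min h i) hc), blk_min h x, key _ _ hj h1⟩
      · exact absurd (h.2.1 _ _ _ h1 h2) hij

lemma arcs_blks {n : ℕ} {A : Finset (ℕ × ℕ)} (h : IsFor 1 (n + 1) A) : arcs n (blks n A) = A := by
  ext ⟨a, b⟩
  rw [mem_arcs (blks_isNCL h)]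
  constructor
  · rintro ⟨l, E, hE, h1, h2⟩
    obtain ⟨i, hi, rfl⟩ := Finset.mem_image.1 hE
    obtain rfl := isMin_unique h1 (blk_min h i)
    exact (mem_blk.1 h2).resolve_left (by omega)
  · intro hab
    have h1 := h.1 _ _ hab
    refine ⟨h1.2.1, blk A a, Finset.mem_image_of_mem _ (Finset.mem_filter.2 ⟨?_, Or.inl ⟨b, hab⟩⟩),
      blk_min h a, mem_blk.2 (Or.inr hab)⟩
    rw [Finset.mem_Icc]; omega

lemma blk_arcs {n : ℕ} {π : Finset (Finset ℕ)} (h : IsNCL n π) {i : ℕ} {E : Finset ℕ}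
    (hE : E ∈ π) (hi : IsMinOf i E) : blk (arcs n π) i = E := by
  ext x
  rw [mem_blk, mem_arcs h]
  constructor
  · rintro (rfl | ⟨_, F, hF, h1, h2⟩)
    · exact hi.1
    · rwa [ncl_min h hE hF hi h1]
  · intro hx
    rcases eq_or_lt_of_le (hi.2 x hx) with e | l
    · exact Or.inl e.symm
    · exact Or.inr ⟨l, E, hE, hi, hx⟩

lemma blks_arcs {n : ℕ} {π : Finset (Finset ℕ)} (h : IsNCL n π) : blks n (arcs n π) = π := by
  ext E
  rw [blks, Finset.mem_image]
  constructor
  · rintro ⟨i, hi, rfl⟩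
    rw [mins, Finset.mem_filter] at hi
    obtain ⟨hin, hi⟩ := hi
    have : ∃ E ∈ π, IsMinOf i E := by
      rcases hi with ⟨b, hb⟩ | hr
      · obtain ⟨_, E, hE, h1, _⟩ := (mem_arcs h).1 hb
        exact ⟨E, hE, h1⟩
      · rw [← h.2.1] at hin
        obtain ⟨E, hE, hiE⟩ := Finset.mem_biUnion.1 hin
        obtain ⟨k, hk⟩ := exists_min (h.1 E hE)
        rcases eq_or_lt_of_le (hk.2 i hiE) with rfl | l
        · exact ⟨E, hE, hk⟩
        · exact absurd ⟨k, (mem_arcs h).2 ⟨l, E, hE, hk, hiE⟩⟩ hr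
    obtain ⟨E, hE, hm⟩ := this
    rwa [blk_arcs h hE hm]
  · intro hE
    obtain ⟨i, hi⟩ := exists_min (h.1 E hE)
    refine ⟨i, ?_, blk_arcs h hE hi⟩
    rw [mins, Finset.mem_filter]
    refine ⟨?_, ?_⟩
    · rw [← h.2.1]
      exact Finset.mem_biUnion.2 ⟨E, hE, hi.1⟩
    · by_cases hr : ∃ a, (a, i) ∈ arcs n π
      · obtain ⟨a, ha⟩ := hr
        obtain ⟨l, F, hF, h1, h2⟩ := (mem_arcs h).1 ha
        have hne : E ≠ F := by
          rintro rfl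
          have := isMin_unique hi h1; omega
        rcases (h.2.2 E hE F hF hne).2 i (Finset.mem_inter.2 ⟨hi.1, h2⟩) with h3 | h3
        · obtain ⟨b, hb, hbi⟩ := Finset.exists_mem_ne h3.2.1 i
          exact Or.inl ⟨b, (mem_arcs h).2
            ⟨lt_of_le_of_ne (hi.2 b hb) (Ne.symm hbi), E, hE, hi, hb⟩⟩
        · exact absurd hi h3.1
      · exact Or.inr hr

lemma weight_eq (α : ℕ → ℂ) {n : ℕ} {A : Finset (ℕ × ℕ)} (h : IsFor 1 (n + 1) A) :
    ∏ i ∈ Finset.Ico 1 (n + 1), α (dg A i) =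
      α 0 ^ (n - (blks n A).card) * ∏ Bl ∈ blks n A, α (Bl.card - 1) := by
  have hinj : Set.InjOn (blk A) (mins n A) := fun i _ j _ e => blk_inj h e
  rw [blks, Finset.card_image_of_injOn hinj, Finset.prod_image hinj]
  simp only [blk_card h, Nat.add_sub_cancel]
  have e : Finset.Ico 1 (n + 1) = Finset.Icc 1 n := by ext; simp [Nat.lt_succ_iff]
  rw [e, ← Finset.prod_filter_not_mul_prod_filter (Finset.Icc 1 n) (isrt A)]
  congr 1
  rw [Finset.prod_congr rfl (g := fun _ => α 0), Finset.prod_const]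
  · congr 1
    have := Finset.card_filter_add_card_filter_not (s := Finset.Icc 1 n) (isrt A)
    rw [Nat.card_Icc] at this
    rw [mins]
    omega
  · intro i hi
    rw [dg_eq_zero]
    intro b hb
    exact (Finset.mem_filter.1 hi).2 (Or.inl ⟨b, hb⟩)

lemma MM_eq_NCL (α : ℕ → ℂ) (n : ℕ) :
    MM α 1 (n + 1) = ∑ π ∈ NCLset n, α 0 ^ (n - π.card) * ∏ Bl ∈ π, α (Bl.card - 1) := by
  rw [MM]
  refine Finset.sum_bij' (fun A _ => blks n A) (fun π _ => arcs n π) ?_ ?_ ?_ ?_ ?_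
  · intro A hA; exact mem_NCLset.2 (blks_isNCL (mem_Fors.1 hA))
  · intro π hπ; exact mem_Fors.2 (arcs_isFor (mem_NCLset.1 hπ))
  · intro A hA; exact arcs_blks (mem_Fors.1 hA)
  · intro π hπ; exact blks_arcs (mem_NCLset.1 hπ)
  · intro A hA; exact weight_eq α (mem_Fors.1 hA)

/-- The scalar case `B = ℂ`: let `(A, φ)` be a `ℂ`-valued noncommutative
probability space, `a ∈ A` with `φ(a) ≠ 0`, and let `α = (α₀, α₁, ...)` be the
T-transform of the distribution series of `a`: identifying a power series
`∑ cₙ zⁿ` with the multilinear function series `l ↦ c_{|l|} ∏ l`, it is the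
unique series `T` with `T(zF(z))(1 + zF(z)) = F(z)`, where
`F(z) = ∑_{n≥0} φ(aⁿ⁺¹) zⁿ`.  Then for every `n ≥ 1`,
`φ(aⁿ) = ∑_{π ∈ NCL(n)} α₀^{n - |π|} ∏_{B ∈ π} α_{|B|-1}`. -/
theorem moments_from_ttransform (A : Type*) [Ring A] [Algebra ℂ A]
    (φ : A →ₗ[ℂ] ℂ) (hφ1 : φ 1 = 1) (a : A) (ha : φ a ≠ 0) (α : ℕ → ℂ)
    (hT : fmul
        (fcomp (fun l : List ℂ => α l.length * l.prod)
          (fmul fmfsI (fun l : List ℂ => φ (a ^ (l.length + 1)) * l.prod)))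
        (fun l : List ℂ =>
          fmfsOne l + fmul fmfsI (fun l' : List ℂ => φ (a ^ (l'.length + 1)) * l'.prod) l)
      = fun l : List ℂ => φ (a ^ (l.length + 1)) * l.prod) :
    ∀ n : ℕ, 1 ≤ n →
      φ (a ^ n) = ∑ π ∈ NCLset n, α 0 ^ (n - π.card) * ∏ Bl ∈ π, α (Bl.card - 1) := by
  intro n _
  have hm0 : (fun k => φ (a ^ k)) 0 = 1 := by simpa using hφ1
  have h := series_rec (fun k => φ (a ^ k)) α hm0 hT
  have := (forest_eq (fun k => φ (a ^ k)) α hm0 h n).1 1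
  rw [← MM_eq_NCL, add_comm n 1, this]
end
end
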